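/- Let τ : ℝ² → ℝ² be the translation (θ, r) ↦ (θ+1, r) and let γ̃ : [0,1] → ℝ² be a curve with γ̃(1) = τ^k(γ̃(0)) for some integer k > 1. If the image of γ̃ is disjoint from its image under τ, then for every nonzero integer m the image of γ̃ is disjoint from its image under τ^m. This is impossible; hence γ̃ must meet τ(γ̃). -/

import Mathlib

open Set

/-- Two continuous logarithms differ by a constant. -/
lemma aux_const (f g : ℝ → ℂ) (hf : Continuous f) (hg : Continuous g)
    (h : ∀ x, Complex.exp (f x) = Complex.exp (g x)) (x y : ℝ) : f x - g x = f y - g y := by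
  have h1 : ∀ x, ∃ n : ℤ, f x = g x + n * (2 * Real.pi * Complex.I) := fun x =>
    Complex.exp_eq_exp_iff_exists_int.1 (h x)
  choose n hn using h1
  have hcn : Continuous n := by
    rw [Int.isClosedEmbedding_coe_real.isInducing.continuous_iff]
    have : ((fun k : ℤ => (k : ℝ)) ∘ n) = fun x => (f x - g x).im / (2 * Real.pi) := by
      funext x
      rw [hn x]
      have := Real.pi_pos
      simp
    rw [this]
    fun_prop
  have : n x = n y := PreconnectedSpace.constant inferInstance hcn
  rw [hn x, hn y, this]; ring

lemma aux_slit (z : ℂ) (h1 : ‖z‖ ≤ 1) (h2 : z ≠ 1) : 1 - z ∈ Complex.slitPlane := by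
  left
  have h3 : z.re ≤ 1 := (Complex.re_le_norm z).trans h1
  rcases h3.lt_or_eq with h | h
  · simpa using h
  · exfalso
    apply h2
    have h4 : Complex.normSq z ≤ 1 := by
      rw [Complex.normSq_eq_norm_sq]; nlinarith [norm_nonneg z]
    rw [Complex.normSq_apply] at h4
    apply Complex.ext
    · simpa using h
    · simp; nlinarith

/-- Winding number argument. -/
lemma aux_core (b : ℝ → ℂ) (hb : Continuous b) (w : ℂ)
    (hb1 : b 1 = b 0 + 2 * Real.pi * Complex.I) (hw : ‖Complex.exp w‖ = 1)
    (hne : ∀ s t, Complex.exp (b s) ≠ Complex.exp (b t + w))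
    (hmax : ∃ t, ∀ s, ‖Complex.exp (b s)‖ ≤ ‖Complex.exp (b t)‖)
    (hmin : ∃ t, ∀ s, ‖Complex.exp (b t)‖ ≤ ‖Complex.exp (b s)‖) : False := by
  obtain ⟨t1, ht1⟩ := hmax
  obtain ⟨t0, ht0⟩ := hmin
  have hper : Complex.exp (b 1) = Complex.exp (b 0) := by
    rw [hb1, Complex.exp_add, Complex.exp_two_pi_mul_I, mul_one]
  let H : C(ℝ × ℝ, ℂ) := ⟨fun p => Complex.exp (b p.1) - Complex.exp (b p.2 + w), by fun_prop⟩
  have hH : ∀ p, H p ∈ ({0}ᶜ : Set ℂ) := fun p => by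
    simpa [H] using sub_ne_zero.2 (hne p.1 p.2)
  obtain ⟨L, ⟨-, hL⟩, -⟩ := Complex.isCoveringMapOn_exp.existsUnique_continuousMap_lifts
    (A := ℝ × ℝ) H (a₀ := (0, 0)) (e₀ := Complex.log (H (0, 0)))
    (Complex.exp_log (by simpa using hH (0, 0))) hH
  have hL' : ∀ s t, Complex.exp (L (s, t)) = Complex.exp (b s) - Complex.exp (b t + w) :=
    fun s t => congrFun hL (s, t)
  have hd := aux_const (fun t => L (1, t)) (fun t => L (0, t)) (by fun_prop) (by fun_prop)
    (fun t => by rw [hL', hL', hper]) t0 t1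
  have e0 := aux_const (fun s => L (s, t0))
    (fun s => b s + Complex.log (1 - Complex.exp (b t0 + w - b s))) (by fun_prop)
    (by
      refine hb.add (Continuous.clog (by fun_prop) fun s => aux_slit _ ?_ ?_)
      · rw [Complex.exp_sub, Complex.exp_add, norm_div, norm_mul, hw, mul_one]
        exact div_le_one_of_le₀ (ht0 s) (norm_nonneg _)
      · rw [Complex.exp_sub]
        intro h
        exact hne s t0 (((div_eq_one_iff_eq (Complex.exp_ne_zero _)).1 h).symm))
    (fun s => by
      rw [hL', Complex.exp_add (b s), Complex.exp_log, mul_sub, ← Complex.exp_add]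
      · ring_nf
      · rw [Complex.exp_sub]
        intro h
        exact hne s t0
          (((div_eq_one_iff_eq (Complex.exp_ne_zero _)).1 (sub_eq_zero.1 h).symm).symm)) 1 0
  have e1 := aux_const (fun s => L (s, t1))
    (fun s => b t1 + w + Real.pi * Complex.I + Complex.log (1 - Complex.exp (b s - (b t1 + w))))
    (by fun_prop)
    (by
      refine continuous_const.add (Continuous.clog (by fun_prop) fun s => aux_slit _ ?_ ?_)
      · rw [Complex.exp_sub, Complex.exp_add, norm_div, norm_mul, hw, mul_one]
        exact div_le_one_of_le₀ (ht1 s) (norm_nonneg _)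
      · rw [Complex.exp_sub]
        intro h
        exact hne s t1 ((div_eq_one_iff_eq (Complex.exp_ne_zero _)).1 h))
    (fun s => by
      rw [hL', Complex.exp_add (b t1 + w + _), Complex.exp_log, mul_sub, ← Complex.exp_add,
        mul_one, Complex.exp_add _ (Real.pi * Complex.I), Complex.exp_pi_mul_I,
        show b t1 + w + Real.pi * Complex.I + (b s - (b t1 + w)) = b s + Real.pi * Complex.I by ring,
        Complex.exp_add _ (Real.pi * Complex.I), Complex.exp_pi_mul_I]
      · ring
      · rw [Complex.exp_sub]
        intro h
        exact hne s t1
          ((div_eq_one_iff_eq (Complex.exp_ne_zero _)).1 (sub_eq_zero.1 h).symm)) 1 0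
  simp only [Complex.exp_sub, hper] at hd e0 e1
  rw [hb1] at e0
  have : (2 * Real.pi * Complex.I : ℂ) = 0 := by linear_combination hd - e0 + e1
  exact Complex.two_pi_I_ne_zero this

/-- No loop in the annulus of degree one whose lift avoids the translates. -/
lemma aux_chord (a : ℝ → ℂ) (s0 t0 : ℝ) (hst : s0 ≤ t0) (ha : ContinuousOn a (Icc s0 t0)) (n : ℤ)
    (hn : n ≠ 0) (hend : a t0 = a s0 + n)
    (hne : ∀ s ∈ Icc s0 t0, ∀ t ∈ Icc s0 t0, ∀ j : ℤ, a s - a t ≠ 1 + n * j) : False := by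
  have hn' : (n : ℂ) ≠ 0 := by exact_mod_cast hn
  let q : ℝ → ℝ := fun u => projIcc s0 t0 hst (s0 + u * (t0 - s0))
  have hq : Continuous q := by
    have := (continuous_projIcc (a := s0) (b := t0) (h := hst))
    fun_prop
  have hqm : ∀ u, q u ∈ Icc s0 t0 := fun u => (projIcc s0 t0 hst _).2
  have hq0 : q 0 = s0 := by simp [q]
  have hq1 : q 1 = t0 := by simp [q]
  have hqs : ∀ x ∈ Icc s0 t0, ∃ u, q u = x := by
    intro x hx
    have := intermediate_value_Icc (zero_le_one (α := ℝ)) hq.continuousOn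
    rw [hq0, hq1] at this
    obtain ⟨u, -, hu⟩ := this hx
    exact ⟨u, hu⟩
  have hnorm : ContinuousOn (fun x => ‖Complex.exp (2 * Real.pi * Complex.I / n * a x)‖)
    (Icc s0 t0) := by fun_prop
  have hpi := Complex.two_pi_I_ne_zero
  refine aux_core (fun u => 2 * Real.pi * Complex.I / n * a (q u)) ?_
    (2 * Real.pi * Complex.I / n) ?_ ?_ ?_ ?_ ?_
  · exact continuous_const.mul (ha.comp_continuous hq hqm)
  · simp only [hq0, hq1, hend]
    field_simp
  · rw [Complex.norm_exp]
    have : (2 * Real.pi * Complex.I / n : ℂ) = ((2 * Real.pi / n : ℝ) : ℂ) * Complex.I := by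
      push_cast; ring
    rw [this]; simp
  · intro s t h
    obtain ⟨j, hj⟩ := Complex.exp_eq_exp_iff_exists_int.1 h
    apply hne (q s) (hqm s) (q t) (hqm t) j
    field_simp at hj
    linear_combination hj
  · obtain ⟨x, hx, hm⟩ := isCompact_Icc.exists_isMaxOn ⟨s0, left_mem_Icc.2 hst⟩ hnorm
    obtain ⟨u, rfl⟩ := hqs x hx
    exact ⟨u, fun s => hm (hqm s)⟩
  · obtain ⟨x, hx, hm⟩ := isCompact_Icc.exists_isMinOn ⟨s0, left_mem_Icc.2 hst⟩ hnorm
    obtain ⟨u, rfl⟩ := hqs x hx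
    exact ⟨u, fun s => hm (hqm s)⟩

/-- Universal chord theorem in the plane. -/
lemma aux_main (a : ℝ → ℂ) (ha : ContinuousOn a (Icc 0 1)) (k : ℤ) (hk : k ≠ 0)
    (hend : a 1 = a 0 + k) (h1 : ∀ s ∈ Icc (0:ℝ) 1, ∀ t ∈ Icc (0:ℝ) 1, a s ≠ a t + 1) : False := by
  let T : Set ℂ := (fun m : ℤ => (m : ℂ)) '' {0}ᶜ
  have hT : IsClosed T := by
    have : T = Complex.ofReal '' ((fun m : ℤ => (m : ℝ)) '' {0}ᶜ) := by
      rw [Set.image_image]; simp [T]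
    rw [this]
    exact Complex.isometry_ofReal.isClosedEmbedding.isClosedMap _
      (Int.isClosedEmbedding_coe_real.isClosedMap _ (isClosed_discrete _))
  let S : Set (ℝ × ℝ) := (Icc 0 1 ×ˢ Icc 0 1) ∩ {p | p.1 ≤ p.2}
  have hS : IsCompact S := (isCompact_Icc.prod isCompact_Icc).inter_right
    (isClosed_le continuous_fst continuous_snd)
  have hcont : ContinuousOn (fun p : ℝ × ℝ => a p.2 - a p.1) S :=
    (ha.comp continuousOn_snd fun p hp => hp.1.2).sub
      (ha.comp continuousOn_fst fun p hp => hp.1.1)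
  have hP : IsCompact (S ∩ (fun p : ℝ × ℝ => a p.2 - a p.1) ⁻¹' T) :=
    hS.of_isClosed_subset (hcont.preimage_isClosed_of_isClosed hS.isClosed hT) inter_subset_left
  have hne : (S ∩ (fun p : ℝ × ℝ => a p.2 - a p.1) ⁻¹' T).Nonempty :=
    ⟨(0, 1), ⟨⟨by simp, by simp⟩, by simp⟩, k, hk, by simp [hend]⟩
  obtain ⟨⟨s0, t0⟩, ⟨⟨⟨hs0, ht0⟩, hle⟩, n, hn, hnd⟩, hmin⟩ := hP.exists_isMinOn hne
    (f := fun p : ℝ × ℝ => p.2 - p.1) (by fun_prop)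
  simp only [mem_ofPred_eq, mem_Icc, mem_compl_iff, mem_singleton_iff] at hs0 ht0 hle hn hnd
  have hsub : ∀ s ∈ Icc s0 t0, s ∈ Icc (0:ℝ) 1 := fun s hs =>
    ⟨hs0.1.trans hs.1, hs.2.trans ht0.2⟩
  have hn1 : n ≠ 1 := by
    rintro rfl
    apply h1 t0 ht0 s0 hs0
    push_cast at hnd
    linear_combination -hnd
  have hn2 : n ≠ -1 := by
    rintro rfl
    apply h1 s0 hs0 t0 ht0
    push_cast at hnd
    linear_combination hnd
  -- integer chords inside the minimal arc are the endpoints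
  have key : ∀ s ∈ Icc s0 t0, ∀ t ∈ Icc s0 t0, s ≤ t → ∀ m : ℤ, m ≠ 0 → a t - a s = m → m = n := by
    intro s hs t ht hst m hm hmd
    have h := hmin (a := (s, t)) ⟨⟨⟨hsub s hs, hsub t ht⟩, hst⟩, m, hm, hmd.symm⟩
    simp only [mem_ofPred_eq] at h
    have e1 : s = s0 := by linarith [hs.1, ht.2]
    have e2 : t = t0 := by linarith [hs.1, ht.2]
    subst e1 e2
    exact_mod_cast hmd.symm.trans hnd.symm
  refine aux_chord a s0 t0 hle (ha.mono hsub) n hn (by rw [hnd]; ring) ?_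
  intro s hs t ht j hj
  have hm0 : (1 + n * j : ℤ) ≠ 0 := by
    intro h
    have : n ∣ 1 := ⟨-j, by linarith⟩
    rcases Int.isUnit_iff.1 (isUnit_of_dvd_one this) with h | h <;> contradiction
  have hcase : (1 + n * j : ℤ) = n ∨ -(1 + n * j : ℤ) = n := by
    rcases le_total t s with h | h
    · left; exact key t ht s hs h _ hm0 (by rw [hj]; push_cast; ring)
    · right
      exact key s hs t ht h _ (neg_ne_zero.2 hm0) (by push_cast; linear_combination -hj)
  have : n ∣ 1 := by
    rcases hcase with h | h
    · exact ⟨1 - j, by linarith⟩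
    · exact ⟨-1 - j, by linarith⟩
  rcases Int.isUnit_iff.1 (isUnit_of_dvd_one this) with h | h <;> contradiction

/-- Let `τ` be the translation `(θ, r) ↦ (θ+1, r)` of the plane, and let `γ̃` be a curve
joining a point to its image under `τ^k` with `k > 1`. If the image of `γ̃` were disjoint
from its `τ`-translate, it would be disjoint from all its `τ^m`-translates (`m ≠ 0`);
this is impossible, hence `γ̃` meets `τ(γ̃)`. -/
theorem stmt4 (γ : ℝ → ℝ × ℝ) (k : ℤ) (hk : 1 < k)
    (hc : ContinuousOn γ (Icc 0 1))
    (hend : γ 1 = ((γ 0).1 + (k : ℝ), (γ 0).2)) :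
    (Disjoint (γ '' Icc (0:ℝ) 1)
        ((fun p : ℝ × ℝ => (p.1 + 1, p.2)) '' (γ '' Icc (0:ℝ) 1)) →
      ∀ m : ℤ, m ≠ 0 →
        Disjoint (γ '' Icc (0:ℝ) 1)
          ((fun p : ℝ × ℝ => (p.1 + (m : ℝ), p.2)) '' (γ '' Icc (0:ℝ) 1))) ∧
    ¬ Disjoint (γ '' Icc (0:ℝ) 1)
        ((fun p : ℝ × ℝ => (p.1 + 1, p.2)) '' (γ '' Icc (0:ℝ) 1)) := by
  have main : ¬ Disjoint (γ '' Icc (0:ℝ) 1)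
        ((fun p : ℝ × ℝ => (p.1 + 1, p.2)) '' (γ '' Icc (0:ℝ) 1)) := by
    intro hd
    rw [Set.disjoint_left] at hd
    refine aux_main (fun s => Complex.equivRealProdCLM.symm (γ s))
      (Complex.equivRealProdCLM.symm.continuous.comp_continuousOn hc) k (by omega) ?_ ?_
    · rw [hend]
      apply Complex.ext <;> simp
    · intro s hs t ht h
      apply hd ⟨s, hs, rfl⟩
      refine ⟨γ t, ⟨t, ht, rfl⟩, ?_⟩
      have hre := congrArg Complex.re h
      have him := congrArg Complex.im h
      simp at hre him
      exact Prod.ext hre.symm him.symm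
  exact ⟨fun h => absurd h main, main⟩
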